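/- Let B be a nonzero C*-algebra, let A := B ⊕ B (the C*-direct sum with coordinatewise operations), and define α : A → A by α(b, b') := (0, b). Then α is a *-homomorphism with ker α = {0} ⊕ B and (ker α)^⊥ = B ⊕ {0}, and for every nonzero b ∈ B one has (b, 0) ∈ (ker α)^⊥ while α(b, 0) = (0, b) ∉ (ker α)^⊥. In particular, the ideal (ker α)^⊥ is not invariant under α-preimages: (ker α)^⊥ ⊄ α^{-1}((ker α)^⊥). (This is the counterexample of the paper's Remark 4.3, showing that the 2^d-tuple 𝒥 need not be a T-family: for the C*-dynamical system over ℤ₊² with α_{(1,0)} = α_{(0,1)} = α one has 𝒥_{{1}} = (ker α)^⊥ ⊄ α_{(0,1)}^{-1}(𝒥_{{1}}).) -/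

import Mathlib

/-- Let `B` be a nonzero C*-algebra, `A := B ⊕ B`, and
`α : A → A, (b, b') ↦ (0, b)`.  Then `α` is a *-homomorphism with `ker α = {0} ⊕ B` and
`(ker α)^⊥ = B ⊕ {0}`; for every nonzero `b ∈ B`, `(b, 0) ∈ (ker α)^⊥` while
`α(b, 0) = (0, b) ∉ (ker α)^⊥`; in particular `(ker α)^⊥ ⊄ α⁻¹((ker α)^⊥)`. -/
theorem stmt_8 {B : Type*} [NonUnitalNormedRing B] [StarRing B] [CStarRing B]
    [NormedSpace ℂ B] [IsScalarTower ℂ B B] [SMulCommClass ℂ B B]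
    [CompleteSpace B] [StarModule ℂ B] [Nontrivial B]
    (α : B × B → B × B) (hα : α = fun p => ((0 : B), p.1))
    (kerα : Set (B × B)) (hker : kerα = {p : B × B | α p = 0})
    (perp : Set (B × B)) (hperp : perp = {a : B × B | ∀ s ∈ kerα, a * s = 0}) :
    (∀ p q : B × B, α (p * q) = α p * α q) ∧
    (∀ p q : B × B, α (p + q) = α p + α q) ∧
    (∀ (c : ℂ) (p : B × B), α (c • p) = c • α p) ∧
    (∀ p : B × B, α (star p) = star (α p)) ∧
    kerα = {p : B × B | p.1 = 0} ∧
    perp = {p : B × B | p.2 = 0} ∧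
    (∀ b : B, b ≠ 0 → ((b, (0 : B)) ∈ perp ∧ α (b, (0 : B)) ∉ perp)) ∧
    ¬ perp ⊆ α ⁻¹' perp := by
  subst hα
  have hker' : kerα = {p : B × B | p.1 = 0} := by
    subst hker
    ext p
    simp [Prod.ext_iff]
  have hperp' : perp = {p : B × B | p.2 = 0} := by
    subst hperp
    rw [hker']
    ext a
    constructor
    · intro ha
      have h := congrArg Prod.snd (ha ((0 : B), star a.2) rfl)
      exact CStarRing.mul_star_self_eq_zero_iff a.2 |>.mp h
    · rintro (ha : a.2 = 0) s (hs : s.1 = 0)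
      simp [Prod.ext_iff, ha, hs]
  have hnonzero : ∀ b : B, b ≠ 0 →
      ((b, (0 : B)) ∈ perp ∧ ((0 : B), b) ∉ perp) := by
    intro b hb
    simp [hperp', hb]
  refine ⟨fun p q => by simp, fun p q => by simp, fun c p => by simp,
    fun p => by simp [Prod.ext_iff], hker', hperp', hnonzero, fun h => ?_⟩
  obtain ⟨b, hb⟩ := exists_ne (0 : B)
  exact (hnonzero b hb).2 (h (hnonzero b hb).1)
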